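/- arXiv:1908.02731 — 3 statements merged into one kernel-verified Lean document; each statement's English description precedes it below -/
import Mathlib

section
/- Let k, ℓ ≥ 1 and let α and β be permutations of the same length such that α avoids ι_{k+1} and β avoids ι_{ℓ+1}. Then α ∘ β avoids δ_{kℓ+1}. Consequently, if A ⊆ D_k and B ⊆ D_ℓ are permutation classes, then A ∘ B ⊆ I_{kℓ}. -/
/-- A permutation of some finite length `n`, bundled with its length. -/
abbrev PermOn : Type := Σ n : ℕ, Equiv.Perm (Fin n)

/-- Pattern containment: `PattLe σ π` means the permutation `π` contains the
pattern `σ`, i.e. there are positions `f u` (strictly increasing in `u`)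
whose values in `π` are order isomorphic to `σ`. -/
def PattLe (σ π : PermOn) : Prop :=
  ∃ f : Fin σ.1 ↪o Fin π.1, ∀ u v : Fin σ.1, σ.2 u < σ.2 v ↔ π.2 (f u) < π.2 (f v)

/-- A permutation class: a set of permutations closed downward under
pattern containment. -/
def IsPermClass (C : Set PermOn) : Prop :=
  ∀ π ∈ C, ∀ σ : PermOn, PattLe σ π → σ ∈ C

/-- The class `C` avoids the permutation `τ`: no element of `C` contains `τ`. -/
def ClassAvoids (C : Set PermOn) (τ : PermOn) : Prop :=
  ∀ σ ∈ C, ¬ PattLe τ σ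

/-- `IsMerge σ α β`: the entries of `σ` can be colored red/blue so that the red
subsequence is order isomorphic to `α` and the blue one to `β`.  The red
positions are the range of `f`, the blue positions the range of `g`. -/
def IsMerge (σ α β : PermOn) : Prop :=
  ∃ (f : Fin α.1 ↪o Fin σ.1) (g : Fin β.1 ↪o Fin σ.1),
    (∀ u v, f u ≠ g v) ∧
    (∀ i : Fin σ.1, (∃ u, f u = i) ∨ (∃ v, g v = i)) ∧
    (∀ u v, α.2 u < α.2 v ↔ σ.2 (f u) < σ.2 (f v)) ∧
    (∀ u v, β.2 u < β.2 v ↔ σ.2 (g u) < σ.2 (g v))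

/-- The merge `A ⊙ B` of two classes. -/
def MergeClass (A B : Set PermOn) : Set PermOn :=
  { σ | ∃ α ∈ A, ∃ β ∈ B, IsMerge σ α β }

/-- The class consisting only of the empty permutation; it is a two-sided
identity for merging, used as base case for iterated merges. -/
def EmptyPermClass : Set PermOn := { σ | σ.1 = 0 }

/-- Iterated merge `A₁ ⊙ A₂ ⊙ ⋯ ⊙ A_k` of a list of classes. -/
def MergeAll (l : List (Set PermOn)) : Set PermOn :=
  l.foldr MergeClass EmptyPermClass

/-- A class is splittable if it is contained in the merge of finitely many
(at least one) proper subclasses. -/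
def Splittable (C : Set PermOn) : Prop :=
  ∃ As : List (Set PermOn), As ≠ [] ∧ (∀ A ∈ As, IsPermClass A ∧ A ⊂ C) ∧
    C ⊆ MergeAll As

/-- The increasing permutation `ι_n = 1 2 ⋯ n`. -/
def iota (n : ℕ) : PermOn := ⟨n, 1⟩

/-- The decreasing permutation `δ_n = n (n-1) ⋯ 1`. -/
def delta (n : ℕ) : PermOn := ⟨n, Fin.revPerm⟩

/-- The class `I` of all increasing permutations. -/
def Iclass : Set PermOn := Set.range iota

/-- The class `D` of all decreasing permutations. -/
def Dclass : Set PermOn := Set.range delta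

/-- The class `I_m` of all permutations avoiding `δ_{m+1}`. -/
def Im (m : ℕ) : Set PermOn := { σ | ¬ PattLe (delta (m + 1)) σ }

/-- The class `D_m` of all permutations avoiding `ι_{m+1}`. -/
def Dm (m : ℕ) : Set PermOn := { σ | ¬ PattLe (iota (m + 1)) σ }

/-- The composition `A ∘ B` of two classes: all `α ∘ β` with `α ∈ A`, `β ∈ B`
of the same length, where `(α ∘ β) i = α (β i)`. -/
def CompClass (A B : Set PermOn) : Set PermOn :=
  { σ | ∃ (n : ℕ) (α β : Equiv.Perm (Fin n)),
      (⟨n, α⟩ : PermOn) ∈ A ∧ (⟨n, β⟩ : PermOn) ∈ B ∧ σ = ⟨n, α * β⟩ }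

/-- The class of all identity permutations; a two-sided identity for
composition of classes, used as base case for iterated compositions. -/
def IdPermClass : Set PermOn := { σ | σ.2 = 1 }

/-- Iterated composition `A₁ ∘ A₂ ∘ ⋯ ∘ A_k` of a list of classes. -/
def CompAll (l : List (Set PermOn)) : Set PermOn :=
  l.foldr CompClass IdPermClass

/-- A class is composable if it is contained in the composition of finitely
many (at least one) proper subclasses. -/
def Composable (C : Set PermOn) : Prop :=
  ∃ As : List (Set PermOn), As ≠ [] ∧ (∀ A ∈ As, IsPermClass A ∧ A ⊂ C) ∧
    C ⊆ CompAll As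

/-- `IsInflation τ π σs`: `τ` is the inflation `π[σs 0, …, σs (n-1)]`.
The bijection `b` sends the `j`-th entry of the `i`-th block to its position in
`τ`; blocks occupy consecutive positions ordered as in `π`'s positions, within
a block positions are ordered as in `σs i`, values of distinct blocks compare
as the corresponding values of `π`, and values within a block compare as in
`σs i`. -/
def IsInflation (τ π : PermOn) (σs : Fin π.1 → PermOn) : Prop :=
  ∃ b : (Σ i : Fin π.1, Fin (σs i).1) ≃ Fin τ.1,
    (∀ (i i' : Fin π.1) (j : Fin (σs i).1) (j' : Fin (σs i').1),
        i < i' → b ⟨i, j⟩ < b ⟨i', j'⟩) ∧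
    (∀ (i : Fin π.1) (j j' : Fin (σs i).1), b ⟨i, j⟩ < b ⟨i, j'⟩ ↔ j < j') ∧
    (∀ (i i' : Fin π.1) (j : Fin (σs i).1) (j' : Fin (σs i').1), i ≠ i' →
        (τ.2 (b ⟨i, j⟩) < τ.2 (b ⟨i', j'⟩) ↔ π.2 i < π.2 i')) ∧
    (∀ (i : Fin π.1) (j j' : Fin (σs i).1),
        τ.2 (b ⟨i, j⟩) < τ.2 (b ⟨i, j'⟩) ↔ (σs i).2 j < (σs i).2 j')

/-- The inflation `A[B]` of the class `A` by the class `B`: all inflations of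
an element of `A` by (nonempty) elements of `B`. -/
def InflClass (A B : Set PermOn) : Set PermOn :=
  { τ | ∃ π ∈ A, ∃ σs : Fin π.1 → PermOn,
      (∀ i, σs i ∈ B ∧ 0 < (σs i).1) ∧ IsInflation τ π σs }

/-- The direct sum `α ⊕ β` of two permutations. -/
def dsum (α β : PermOn) : PermOn :=
  ⟨α.1 + β.1, finSumFinEquiv.symm.trans ((α.2.sumCongr β.2).trans finSumFinEquiv)⟩

/-- Iterated direct sum `π₁ ⊕ π₂ ⊕ ⋯ ⊕ π_n` of a list of permutations. -/
def bigDsum : List PermOn → PermOn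
  | [] => ⟨0, 1⟩
  | p :: l => dsum p (bigDsum l)

/-- The reversal `π^r` of a permutation `π`. -/
def revP (p : PermOn) : PermOn := ⟨p.1, p.2 * Fin.revPerm⟩

/-- Composition of two bundled permutations of the same length,
`(pcomp a b) i = a (b i)`; if the lengths differ it defaults to `a`. -/
def pcomp (a b : PermOn) : PermOn :=
  if h : b.1 = a.1 then ⟨a.1, a.2 * (finCongr h).permCongr b.2⟩ else a

/-- Either `g` is strictly increasing along some `m + 1` points, or the points can be labelled
with `m` labels that increase along every increasing pair of `g`. -/
theorem exists_strictMono_comp_or_exists_labelling {ι κ : Type*} [LinearOrder ι] [LinearOrder κ]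
    (g : ι → κ) (hg : Function.Injective g) (m : ℕ) :
    (∃ e : Fin (m + 1) → ι, StrictMono e ∧ StrictMono (g ∘ e)) ∨
      ∃ c : ι → Fin m, ∀ u v, u < v → g u < g v → c u < c v := by
  let P := {p : ι × κ // p.2 = g p.1}
  let x : ι → P := fun u => ⟨(u, g u), rfl⟩
  by_cases h : ∀ p : P, Order.height p < m
  · right
    have lift (p : P) : ((Order.height p).toNat : ℕ∞) = Order.height p :=
      ENat.natCast_toNat (h p).ne_top
    refine ⟨fun u => ⟨(Order.height (x u)).toNat, ?_⟩, fun u v huv hguv => ?_⟩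
    · have := h (x u)
      rw [← lift] at this
      exact_mod_cast this
    · have hlt : x u < x v := Prod.mk_lt_mk.2 (Or.inl ⟨huv, hguv.le⟩)
      have := Order.height_strictMono hlt ((h (x u)).trans (ENat.natCast_lt_top m))
      rw [← lift (x u), ← lift (x v)] at this
      exact Fin.mk_lt_mk.2 (by exact_mod_cast this)
  · left
    push Not at h
    obtain ⟨p, hp⟩ := h
    obtain ⟨s, -, hs⟩ := Order.exists_series_of_le_height p hp
    subst hs
    have mono (a b : Fin (s.length + 1)) (hab : a < b) :
        (s a).1.1 < (s b).1.1 ∧ g (s a).1.1 < g (s b).1.1 := by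
      have hlt : (s a).1 < (s b).1 := s.strictMono hab
      have hne : (s a).1.1 ≠ (s b).1.1 := fun he =>
        hlt.ne (Prod.ext he (by rw [(s a).2, (s b).2, he]))
      have hle : g (s a).1.1 ≤ g (s b).1.1 := by
        rw [← (s a).2, ← (s b).2]
        exact hlt.le.2
      exact ⟨lt_of_le_of_ne hlt.le.1 hne, lt_of_le_of_ne hle (hg.ne hne)⟩
    exact ⟨fun a => (s a).1.1, fun a b hab => (mono a b hab).1, fun a b hab => (mono a b hab).2⟩

/-- The Erdős–Szekeres theorem. -/
theorem exists_strictMono_or_strictAnti_comp {ι κ : Type*} [LinearOrder ι] [Fintype ι]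
    [LinearOrder κ] (g : ι → κ) (hg : Function.Injective g) (k l : ℕ)
    (hcard : k * l < Fintype.card ι) :
    (∃ e : Fin (l + 1) → ι, StrictMono e ∧ StrictMono (g ∘ e)) ∨
      ∃ e : Fin (k + 1) → ι, StrictMono e ∧ StrictAnti (g ∘ e) := by
  rcases exists_strictMono_comp_or_exists_labelling g hg l with h | ⟨c, hc⟩
  · exact Or.inl h
  rcases exists_strictMono_comp_or_exists_labelling (OrderDual.toDual ∘ g)
    (OrderDual.toDual.injective.comp hg) k with ⟨e, he, hge⟩ | ⟨d, hd⟩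
  · exact Or.inr ⟨e, he, fun a b hab => hge hab⟩
  exfalso
  refine hcard.not_ge ?_
  have inj : Function.Injective fun u => (d u, c u) := by
    intro u v huv
    rw [Prod.mk.injEq] at huv
    have key (u v : ι) (hlt : u < v) (hd' : d u = d v) (hc' : c u = c v) : False := by
      rcases lt_or_gt_of_ne (hg.ne hlt.ne) with h | h
      · exact (hc u v hlt h).ne hc'
      · exact (hd u v hlt h).ne hd'
    rcases lt_trichotomy u v with h | h | h
    · exact (key u v h huv.1 huv.2).elim
    · exact h
    · exact (key v u h huv.1.symm huv.2.symm).elim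
  simpa using Fintype.card_le_of_injective _ inj

/-- A permutation that increases along `m` increasing positions contains `ι_m`. -/
theorem pattLe_iota_of_strictMono {m n : ℕ} {π : Equiv.Perm (Fin n)} {e : Fin m → Fin n}
    (he : StrictMono e) (hπ : StrictMono (π ∘ e)) : PattLe (iota m) ⟨n, π⟩ :=
  ⟨OrderEmbedding.ofStrictMono e he, fun _ _ => hπ.lt_iff_lt.symm⟩

/-- If `α` avoids `ι_{k+1}` and `β` avoids `ι_{l+1}`, then `α ∘ β` avoids `δ_{kl+1}`. -/
theorem not_pattLe_delta_mul {k l n : ℕ} {α β : Equiv.Perm (Fin n)}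
    (hα : ¬ PattLe (iota (k + 1)) ⟨n, α⟩) (hβ : ¬ PattLe (iota (l + 1)) ⟨n, β⟩) :
    ¬ PattLe (delta (k * l + 1)) ⟨n, α * β⟩ := by
  rintro ⟨f, hf⟩
  change Fin (k * l + 1) ↪o Fin n at f
  have anti : StrictAnti fun u => α (β (f u)) := fun u v huv =>
    (hf v u).1 (Fin.rev_lt_rev.2 huv)
  rcases exists_strictMono_or_strictAnti_comp (β ∘ f) (β.injective.comp f.injective) k l
    (by simp) with ⟨e, he, hβe⟩ | ⟨e, he, hβe⟩
  · exact hβ (pattLe_iota_of_strictMono (f.strictMono.comp he) hβe)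
  · exact hα (pattLe_iota_of_strictMono (hβe.comp Fin.rev_strictAnti)
      ((anti.comp_strictMono he).comp Fin.rev_strictAnti))

/-- If `α` avoids `ι_{k+1}` and `β` avoids `ι_{ℓ+1}` (same
length), then `α ∘ β` avoids `δ_{kℓ+1}`; consequently for permutation classes
`A ⊆ D_k` and `B ⊆ D_ℓ` one has `A ∘ B ⊆ I_{kℓ}`. -/
theorem stmt_11 (k l : ℕ) (hk : 1 ≤ k) (hl : 1 ≤ l) :
    (∀ (n : ℕ) (α β : Equiv.Perm (Fin n)),
      ¬ PattLe (iota (k + 1)) ⟨n, α⟩ → ¬ PattLe (iota (l + 1)) ⟨n, β⟩ →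
      ¬ PattLe (delta (k * l + 1)) ⟨n, α * β⟩) ∧
    (∀ A B : Set PermOn, IsPermClass A → IsPermClass B →
      A ⊆ Dm k → B ⊆ Dm l → CompClass A B ⊆ Im (k * l)) := by
  refine ⟨fun n α β hα hβ => not_pattLe_delta_mul hα hβ, ?_⟩
  rintro A B - - hA hB _ ⟨n, α, β, hα, hβ, rfl⟩
  exact not_pattLe_delta_mul (hA hα) (hB hβ)
end

section
/- Let π and η be permutations of the same length, and suppose η avoids δ_{n+1} (i.e., η ∈ I_n). Then π ∘ η is a merge of n permutations each of which is contained in π. Consequently, for any permutation class A, A ∘ I_n ⊆ A ⊙ A ⊙ ⋯ ⊙ A (n copies). -/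
/-- Every set of positions of a permutation is the image of an embedded pattern. -/
theorem exists_pattern_of_finset (σ : PermOn) (S : Finset (Fin σ.1)) :
    ∃ (α : PermOn) (f : Fin α.1 ↪o Fin σ.1), (∀ i, i ∈ S ↔ ∃ u, f u = i) ∧
      ∀ u v, α.2 u < α.2 v ↔ σ.2 (f u) < σ.2 (f v) := by
  let f := S.orderEmbOfFin rfl
  let g := (S.map σ.2.toEmbedding).orderIsoOfFin (Finset.card_map _)
  have hf : ∀ u, σ.2 (f u) ∈ S.map σ.2.toEmbedding := fun u =>
    Finset.mem_map_of_mem σ.2.toEmbedding (S.orderEmbOfFin_mem rfl u)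
  let p : Fin S.card → Fin S.card := fun u => g.symm ⟨σ.2 (f u), hf u⟩
  have hp : Function.Injective p := fun u v h => by
    have h' := g.symm.injective h
    simpa using h'
  refine ⟨⟨S.card, Equiv.ofBijective p (Finite.injective_iff_bijective.mp hp)⟩, f, ?_, ?_⟩
  · intro i
    rw [← Set.mem_range, S.range_orderEmbOfFin rfl, Finset.mem_coe]
  · intro u v
    simp [p]

/-- If `η` has no decreasing subsequence of length `n + 1`, then `σ` is a merge of `n` of its
patterns, each embedded along positions on which `η` is increasing. -/
theorem exists_merge_strictMono {M : Type*} [LinearOrder M] (n : ℕ) (σ : PermOn)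
    (η : Fin σ.1 → M) (hη : Function.Injective η)
    (h : ¬ ∃ f : Fin (n + 1) → Fin σ.1, StrictMono f ∧ StrictAnti (η ∘ f)) :
    ∃ αs : List PermOn, αs.length = n ∧
      (∀ α ∈ αs, ∃ f : Fin α.1 ↪o Fin σ.1, StrictMono (η ∘ f) ∧
        ∀ u v, α.2 u < α.2 v ↔ σ.2 (f u) < σ.2 (f v)) ∧
      σ ∈ MergeAll (αs.map fun α => ({α} : Set PermOn)) := by
  induction n generalizing σ with
  | zero =>
    refine ⟨[], rfl, by simp, ?_⟩
    by_contra hσ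
    exact h ⟨fun _ => ⟨0, Nat.pos_of_ne_zero hσ⟩, Subsingleton.strictMono (α := Fin 1) _,
      Subsingleton.strictAnti (α := Fin 1) _⟩
  | succ n ih =>
    classical
    let S : Finset (Fin σ.1) := {i | ∀ j < i, η j < η i}
    obtain ⟨α, f, hfS, hf⟩ := exists_pattern_of_finset σ S
    obtain ⟨β, g, hgS, hg⟩ := exists_pattern_of_finset σ Sᶜ
    obtain ⟨αs, hlen, hαs, hβ⟩ := ih β (η ∘ g) (hη.comp g.injective) (by
      rintro ⟨k, hk, hk'⟩
      have h0 : g (k 0) ∈ Sᶜ := (hgS _).2 ⟨_, rfl⟩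
      simp only [S, Finset.mem_compl, Finset.mem_filter, Finset.mem_univ, true_and, not_forall,
        not_lt] at h0
      obtain ⟨j, hj, hle⟩ := h0
      have hlt : η (g (k 0)) < η j := hle.lt_of_ne fun e => hj.ne (hη e).symm
      refine h ⟨Fin.cons j (g ∘ k), ?_, ?_⟩
      · rw [Fin.strictMono_iff_lt_succ]
        refine Fin.cases (by simpa using hj) fun i => ?_
        have := g.strictMono (hk i.castSucc_lt_succ)
        simpa [← Fin.succ_castSucc] using this
      · rw [Fin.strictAnti_iff_succ_lt]
        refine Fin.cases (by simpa using hlt) fun i => ?_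
        have := hk' i.castSucc_lt_succ
        simpa [← Fin.succ_castSucc] using this)
    refine ⟨α :: αs, by simp [hlen], ?_, α, rfl, β, hβ, f, g, ?_, ?_, hf, hg⟩
    · intro γ hγ
      rcases List.mem_cons.1 hγ with rfl | hγ
      · refine ⟨f, fun u v huv => ?_, hf⟩
        have hv : f v ∈ S := (hfS _).2 ⟨v, rfl⟩
        exact (Finset.mem_filter.1 hv).2 _ (f.strictMono huv)
      · obtain ⟨k, hk, hk'⟩ := hαs γ hγ
        exact ⟨k.trans g, hk, fun u v => (hk' u v).trans (hg _ _)⟩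
    · intro u v e
      exact Finset.mem_compl.1 ((hgS _).2 ⟨v, rfl⟩) ((hfS _).2 ⟨u, e⟩)
    · intro i
      by_cases hi : i ∈ S
      · exact .inl ((hfS i).1 hi)
      · exact .inr ((hgS i).1 (Finset.mem_compl.2 hi))

theorem mergeAll_singletons_subset_replicate {A : Set PermOn} (αs : List PermOn)
    (h : ∀ α ∈ αs, α ∈ A) :
    MergeAll (αs.map fun α => ({α} : Set PermOn)) ⊆ MergeAll (List.replicate αs.length A) := by
  induction αs with
  | nil => exact subset_rfl
  | cons α αs ih =>
    rintro σ ⟨_, rfl, β, hβ, hm⟩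
    exact ⟨_, h _ (by simp), β, ih (fun γ hγ => h γ (by simp [hγ])) hβ, hm⟩

/-- Composing `π` with a permutation avoiding `δ_{n+1}` gives a merge of `n` patterns of `π`. -/
theorem exists_merge_patterns_of_mem_Im {n N : ℕ} (π η : Equiv.Perm (Fin N))
    (hη : (⟨N, η⟩ : PermOn) ∈ Im n) :
    ∃ αs : List PermOn, αs.length = n ∧ (∀ α ∈ αs, PattLe α ⟨N, π⟩) ∧
      (⟨N, π * η⟩ : PermOn) ∈ MergeAll (αs.map fun α => ({α} : Set PermOn)) := by
  obtain ⟨αs, hlen, hαs, hm⟩ := exists_merge_strictMono n ⟨N, π * η⟩ η η.injective (by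
    rintro ⟨f, hf, hf'⟩
    refine hη ⟨OrderEmbedding.ofStrictMono f hf, fun u v => ?_⟩
    exact Fin.rev_lt_rev.trans hf'.lt_iff_gt.symm)
  refine ⟨αs, hlen, fun α hα => ?_, hm⟩
  obtain ⟨f, hf, hf'⟩ := hαs α hα
  exact ⟨OrderEmbedding.ofStrictMono _ hf, hf'⟩

/-- If `η` avoids `δ_{n+1}`, then `π ∘ η` is a merge of `n`
permutations each of which is a pattern of `π`; consequently, for any
permutation class `A`, `A ∘ I_n` is contained in the merge of `n` copies
of `A`. -/
theorem stmt_14 (n : ℕ) :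
    (∀ (N : ℕ) (π η : Equiv.Perm (Fin N)),
      (⟨N, η⟩ : PermOn) ∈ Im n →
      ∃ αs : List PermOn, αs.length = n ∧
        (∀ α ∈ αs, PattLe α ⟨N, π⟩) ∧
        (⟨N, π * η⟩ : PermOn) ∈ MergeAll (αs.map fun α => ({α} : Set PermOn))) ∧
    (∀ A : Set PermOn, IsPermClass A →
      CompClass A (Im n) ⊆ MergeAll (List.replicate n A)) := by
  refine ⟨fun N π η hη => exists_merge_patterns_of_mem_Im π η hη, ?_⟩
  rintro A hA _ ⟨N, π, η, hπ, hη, rfl⟩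
  obtain ⟨αs, rfl, hαs, hm⟩ := exists_merge_patterns_of_mem_Im π η hη
  exact mergeAll_singletons_subset_replicate αs (fun α hα => hA _ hπ α (hαs α hα)) hm
end

section
/- Let C be a permutation class that avoids some permutation of length m+1, and suppose C = A ⊙ B where A and B are nonempty proper subclasses of C. Then A avoids some permutation of length m and B avoids some permutation of length m. -/
theorem PattLe.refl (σ : PermOn) : PattLe σ σ :=
  ⟨RelEmbedding.refl _, fun _ _ => Iff.rfl⟩

theorem IsMerge.symm {σ α β : PermOn} (h : IsMerge σ α β) : IsMerge σ β α := by
  obtain ⟨f, g, hne, hcov, hf, hg⟩ := h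
  exact ⟨g, f, fun u v e => hne v u e.symm, fun i => (hcov i).symm, hg, hf⟩

theorem mergeClass_comm (A B : Set PermOn) : MergeClass A B = MergeClass B A := by
  ext σ
  exact ⟨fun ⟨α, hα, β, hβ, h⟩ => ⟨β, hβ, α, hα, h.symm⟩,
    fun ⟨β, hβ, α, hα, h⟩ => ⟨α, hα, β, hβ, h.symm⟩⟩

/-- Merging with an empty permutation adds nothing. -/
theorem IsMerge.pattLe_left {σ α β : PermOn} (h : IsMerge σ α β) (hβ : β.1 = 0) :
    PattLe σ α := by
  obtain ⟨f, g, -, hcov, hf, -⟩ := h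
  have hsurj : Function.Surjective f := fun i => (hcov i).resolve_right fun ⟨v, _⟩ => by
    have := v.2
    omega
  let e : Fin α.1 ≃o Fin σ.1 := RelIso.ofSurjective f hsurj
  have he : ∀ i, f (e.symm i) = i := e.apply_symm_apply
  exact ⟨e.symm.toOrderEmbedding, fun u v => by
    have := hf (e.symm u) (e.symm v)
    rw [he, he] at this
    exact this.symm⟩

/-- Every permutation of length `m + 1` is a merge of a permutation of length `m` and a
single point. -/
theorem exists_isMerge_point {m : ℕ} (t : Equiv.Perm (Fin (m + 1))) :
    ∃ s : Equiv.Perm (Fin m), IsMerge ⟨m + 1, t⟩ ⟨m, s⟩ ⟨1, 1⟩ := by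
  let s : Equiv.Perm (Fin m) := (finSuccAboveEquiv (0 : Fin (m + 1))).trans
    ((t.subtypeEquiv fun a => (t.injective.ne_iff (x := a) (y := 0)).symm).trans
      (finSuccAboveEquiv (t 0)).symm)
  have hs : ∀ i, (t 0).succAbove (s i) = t i.succ := fun i =>
    congrArg Subtype.val ((finSuccAboveEquiv (t 0)).apply_symm_apply
      ⟨t i.succ, t.injective.ne (Fin.succ_ne_zero i)⟩)
  refine ⟨s, Fin.succOrderEmb m, OrderEmbedding.ofStrictMono (fun _ => 0)
    (Subsingleton.strictMono _), fun u _ => Fin.succ_ne_zero u, fun i => ?_,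
    fun u v => ?_, fun u v => ?_⟩
  · induction i using Fin.cases with
    | zero => exact Or.inr ⟨0, rfl⟩
    | succ i => exact Or.inl ⟨i, rfl⟩
  · change s u < s v ↔ t u.succ < t v.succ
    rw [← hs, ← hs, Fin.succAbove_lt_succAbove_iff]
  · rw [Subsingleton.elim u v]
    simp

theorem IsPermClass.point_mem {B : Set PermOn} (hB : IsPermClass B) {β : PermOn}
    (hβ : β ∈ B) (hpos : β.1 ≠ 0) : (⟨1, 1⟩ : PermOn) ∈ B :=
  hB β hβ _ ⟨OrderEmbedding.ofStrictMono (fun _ => ⟨0, Nat.pos_of_ne_zero hpos⟩)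
    (Subsingleton.strictMono _), fun u v => by
      rw [Subsingleton.elim u v]
      simp⟩

theorem exists_classAvoids_left {m : ℕ} {A B : Set PermOn}
    (hA : IsPermClass A) (hB : IsPermClass B) (hproper : A ⊂ MergeClass A B)
    (hav : ∃ τ : PermOn, τ.1 = m + 1 ∧ ClassAvoids (MergeClass A B) τ) :
    ∃ τ : PermOn, τ.1 = m ∧ ClassAvoids A τ := by
  obtain ⟨β, hβ, hpos⟩ : ∃ β ∈ B, β.1 ≠ 0 := by
    by_contra! h
    exact hproper.2 fun σ ⟨α, hα, β, hβ, hm⟩ => hA α hα σ (hm.pattLe_left (h β hβ))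
  obtain ⟨⟨_, t⟩, rfl, hτ⟩ := hav
  obtain ⟨s, hs⟩ := exists_isMerge_point t
  exact ⟨⟨m, s⟩, rfl, fun α hα hle =>
    hτ _ ⟨_, hA α hα _ hle, _, hB.point_mem hβ hpos, hs⟩ (PattLe.refl _)⟩

/-- If `C` avoids some permutation of length `m+1` and
`C = A ⊙ B` for nonempty proper subclasses `A, B ⊊ C`, then `A` avoids some
permutation of length `m` and `B` avoids some permutation of length `m`. -/
theorem stmt_16 (m : ℕ) (C A B : Set PermOn)
    (hC : IsPermClass C) (hA : IsPermClass A) (hB : IsPermClass B)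
    (hAne : A.Nonempty) (hBne : B.Nonempty) (hApr : A ⊂ C) (hBpr : B ⊂ C)
    (hav : ∃ τ : PermOn, τ.1 = m + 1 ∧ ClassAvoids C τ)
    (heq : C = MergeClass A B) :
    (∃ τ : PermOn, τ.1 = m ∧ ClassAvoids A τ) ∧
    (∃ τ : PermOn, τ.1 = m ∧ ClassAvoids B τ) := by
  subst heq
  refine ⟨exists_classAvoids_left hA hB hApr hav, ?_⟩
  rw [mergeClass_comm] at hBpr hav
  exact exists_classAvoids_left hB hA hBpr hav
end
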